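/- Let U be a normal ultrafilter on a measurable cardinal δ and let κ be a singular cardinal of cofinality δ with 2^κ = κ⁺ and the property that λ^δ < κ holds for all cardinals λ < κ. If there exists a □_κ-sequence, then there is a closed unbounded subset of κ⁺ that is fresh over Ult(V,U). -/

import Mathlib

noncomputable section

open Cardinal Set

namespace MU

/-- The type of ordinals below the initial ordinal of `δ`, serving as the underlying
set of the cardinal `δ` and indexing the ultrapower. -/
abbrev Idx (δ : Cardinal.{0}) : Type 1 := {o : Ordinal.{0} // o < δ.ord}

/-- A filter `F` is `κ`-complete (equivalently, `<κ`-closed): it is closed under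
intersections of fewer than `κ` of its members. -/
def IsCComplete (κ : Cardinal.{0}) {X : Type*} (F : Filter X) : Prop :=
  ∀ (ι : Type) (t : ι → Set X), #ι < κ → (∀ j, t j ∈ F) → (⋂ j, t j) ∈ F

/-- `U` is a normal ultrafilter on the measurable cardinal `δ`: `δ` is uncountable and
`U` is a `δ`-complete nonprincipal ultrafilter on `δ` such that every function that is
regressive on a set in `U` is constant on a set in `U`. -/
structure IsNormalUltrafilter (δ : Cardinal.{0}) (U : Ultrafilter (Idx δ)) : Prop where
  uncountable : ℵ₀ < δ
  complete : IsCComplete δ (U : Filter (Idx δ))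
  nonprincipal : ∀ i : Idx δ, ({i} : Set (Idx δ)) ∉ U
  normal : ∀ f : Idx δ → Ordinal.{0}, { i : Idx δ | f i < i.1 } ∈ U →
    ∃ c : Ordinal.{0}, { i : Idx δ | f i = c } ∈ U

variable {δ : Cardinal.{0}} {U : Ultrafilter (Idx δ)}

/-- The Łoś ordering on representatives of ordinals of the ultrapower `Ult(V,U)`. -/
def ultLT (U : Ultrafilter (Idx δ)) (f g : Idx δ → Ordinal.{0}) : Prop :=
  { i : Idx δ | f i < g i } ∈ U

theorem ultLT_wf (hU : IsNormalUltrafilter δ U) : WellFounded (ultLT U) := by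
  haveI : IsIrrefl (Idx δ → Ordinal.{0}) (ultLT U) := by
    constructor
    intro f hf
    have h : ({ i : Idx δ | f i < f i } : Set (Idx δ)) = ∅ := by ext i; simp
    rw [ultLT, h] at hf
    exact Filter.empty_notMem (U : Filter (Idx δ)) hf
  haveI : IsTrans (Idx δ → Ordinal.{0}) (ultLT U) := by
    constructor
    intro f g h hfg hgh
    have hsub : ({ i : Idx δ | f i < g i } ∩ { i : Idx δ | g i < h i } : Set (Idx δ)) ⊆
        { i : Idx δ | f i < h i } := fun i hi => show f i < h i from lt_trans hi.1 hi.2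
    exact Filter.mem_of_superset (Filter.inter_mem hfg hgh) hsub
  haveI : IsStrictOrder (Idx δ → Ordinal.{0}) (ultLT U) := ⟨⟩
  rw [RelEmbedding.wellFounded_iff_isEmpty]
  constructor
  intro g
  have hmem : ∀ n : ℕ, { i : Idx δ | g (n + 1) i < g n i } ∈ U :=
    fun n => g.map_rel_iff.2 (Nat.lt_succ_self n)
  have hint : (⋂ n : ℕ, { i : Idx δ | g (n + 1) i < g n i }) ∈ U := by
    refine hU.complete ℕ _ ?_ hmem
    rw [Cardinal.mk_nat]
    exact hU.uncountable
  obtain ⟨i, hi⟩ := Ultrafilter.nonempty_of_mem hint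
  have hdesc : ∀ n : ℕ, (fun n => g n i) (n + 1) < (fun n => g n i) n :=
    fun n => Set.mem_iInter.1 hi n
  exact (RelEmbedding.wellFounded_iff_isEmpty.1 Ordinal.lt_wf).false
    (RelEmbedding.natGT (fun n => g n i) hdesc)

/-- The ordinal represented by `f` in the transitive collapse of the ultrapower
`Ult(V,U)`, i.e. the rank of `f` in the (well-founded) Łoś ordering. -/
def ordRank (hU : IsNormalUltrafilter δ U) (f : Idx δ → Ordinal.{0}) : Ordinal.{0} :=
  sInf { o : Ordinal.{0} | Ordinal.lift.{1} o = ((ultLT_wf hU).apply f).rank }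

/-- The image of an ordinal under the ultrapower embedding `j_U : V → Ult(V,U)`. -/
def jU (hU : IsNormalUltrafilter δ U) (o : Ordinal.{0}) : Ordinal.{0} :=
  ordRank hU fun _ => o

/-- The set of ordinals that is the transitive collapse of the element of the
ultrapower `Ult(V,U)` represented by the function `f`. -/
def ultSet (hU : IsNormalUltrafilter δ U) (f : Idx δ → Set Ordinal.{0}) :
    Set Ordinal.{0} :=
  { o : Ordinal.{0} |
    ∃ g : Idx δ → Ordinal.{0}, { i : Idx δ | g i ∈ f i } ∈ U ∧ ordRank hU g = o }

/-- A set of ordinals is (the transitive collapse of) an element of the ultrapower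
`Ult(V,U)`. -/
def InUlt (hU : IsNormalUltrafilter δ U) (A : Set Ordinal.{0}) : Prop :=
  ∃ f : Idx δ → Set Ordinal.{0}, (∀ i, BddAbove (f i)) ∧ A = ultSet hU f

/-- The least upper bound of a set of ordinals. -/
def lub (A : Set Ordinal.{0}) : Ordinal.{0} :=
  sSup ((fun o => o + 1) '' A)

/-- Hamkins: a set `A` of ordinals is fresh over `Ult(V,U)` if `A ∉ Ult(V,U)` but
`A ∩ α ∈ Ult(V,U)` for every `α < lub A`. -/
def Fresh (hU : IsNormalUltrafilter δ U) (A : Set Ordinal.{0}) : Prop :=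
  ¬ InUlt hU A ∧ ∀ α < lub A, InUlt hU (A ∩ Iio α)

/-- `A` is an unbounded subset of the ordinal `l`. -/
def UnbSub (A : Set Ordinal.{0}) (l : Ordinal.{0}) : Prop :=
  A ⊆ Iio l ∧ ∀ b < l, ∃ a ∈ A, b ≤ a

/-- `A` is a closed subset of the ordinal `l`: it contains the suprema of all of its
nonempty subsets that are bounded below `l`. -/
def ClosedIn (A : Set Ordinal.{0}) (l : Ordinal.{0}) : Prop :=
  ∀ S ⊆ A, S.Nonempty → sSup S < l → sSup S ∈ A

/-- The set of limit points of a set of ordinals. -/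
def limitPts (A : Set Ordinal.{0}) : Set Ordinal.{0} :=
  { b : Ordinal.{0} | (A ∩ Iio b).Nonempty ∧ sSup (A ∩ Iio b) = b }

/-- `S` is a stationary subset of the ordinal `l`. -/
def StationaryIn (S : Set Ordinal.{0}) (l : Ordinal.{0}) : Prop :=
  S ⊆ Iio l ∧ ∀ D : Set Ordinal.{0}, ClosedIn D l → UnbSub D l → (S ∩ D).Nonempty

/-- The order type of the set of ordinals `C` is at most `o`. -/
def otpLE (C : Set Ordinal.{0}) (o : Ordinal.{0}) : Prop :=
  ∃ g : Ordinal.{0} → Ordinal.{0}, (∀ a ∈ C, g a < o) ∧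
    ∀ a ∈ C, ∀ b ∈ C, a < b → g a < g b

/-- The order type of the set of ordinals `C` is (strictly) less than `o`. -/
def otpLT (C : Set Ordinal.{0}) (o : Ordinal.{0}) : Prop :=
  ∃ o' < o, otpLE C o'

/-- `C` is a `□(Θ)`-sequence, where `Θ` is (the initial ordinal of) an uncountable
regular cardinal. -/
structure IsSquareSeq (Θ : Ordinal.{0}) (C : Ordinal.{0} → Set Ordinal.{0}) : Prop where
  closed : ∀ γ < Θ, Order.IsSuccLimit γ → ClosedIn (C γ) γ
  unbounded : ∀ γ < Θ, Order.IsSuccLimit γ → UnbSub (C γ) γ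
  coherent : ∀ γ < Θ, Order.IsSuccLimit γ → ∀ β ∈ limitPts (C γ), β < γ → C β = C γ ∩ Iio β
  nontrivial : ¬ ∃ D : Set Ordinal.{0}, ClosedIn D Θ ∧ UnbSub D Θ ∧
    ∀ γ ∈ limitPts D, γ < Θ → D ∩ Iio γ = C γ

/-- `C` is a `□_κ`-sequence: a `□(κ⁺)`-sequence all of whose clubs have order type
at most `κ`. -/
def IsSquareKappaSeq (κ : Cardinal.{0}) (C : Ordinal.{0} → Set Ordinal.{0}) : Prop :=
  IsSquareSeq (Order.succ κ).ord C ∧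
    ∀ γ < (Order.succ κ).ord, Order.IsSuccLimit γ → otpLE (C γ) κ.ord

/-- `κ` is a weakly compact cardinal: `κ` is uncountable and every coloring of the
pairs of ordinals below `κ` in fewer than `κ` colors has a homogeneous set of size `κ`. -/
def IsWeaklyCompact (κ : Cardinal.{0}) : Prop :=
  ℵ₀ < κ ∧ ∀ (ν : Type) (c : Ordinal.{0} → Ordinal.{0} → ν), #ν < κ →
    ∃ H : Set Ordinal.{0}, H ⊆ Iio κ.ord ∧ Cardinal.lift.{1} κ ≤ #H ∧
      ∀ a ∈ H, ∀ b ∈ H, ∀ a' ∈ H, ∀ b' ∈ H, a < b → a' < b' → c a b = c a' b'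

/-- `κ` is a strongly compact cardinal: every `κ`-complete filter (on any set)
extends to a `κ`-complete ultrafilter. -/
def IsStronglyCompact (κ : Cardinal.{0}) : Prop :=
  ∀ (X : Type) (F : Filter X), IsCComplete κ F →
    ∃ G : Ultrafilter X, F ≤ (G : Filter X) ∧ IsCComplete κ (G : Filter X)

/-- `κ` is a singular cardinal. -/
def IsSingular (κ : Cardinal.{0}) : Prop :=
  ℵ₀ ≤ κ ∧ κ.ord.cof < κ

/-- The cofinality of the ordinal `l` as computed inside the ultrapower `Ult(V,U)`
(as an ordinal, i.e. the image of the ultrapower's cofinality under the transitive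
collapse). -/
def cofUlt (hU : IsNormalUltrafilter δ U) (l : Ordinal.{0}) : Ordinal.{0} :=
  sInf { c : Ordinal.{0} | ∃ f : Idx δ → Ordinal.{0},
    ordRank hU f = l ∧ ordRank hU (fun i => ((f i).cof).ord) = c }

/-- The ordinal `o` is (the transitive collapse of) a cardinal of the ultrapower
`Ult(V,U)`. -/
def CardInUlt (hU : IsNormalUltrafilter δ U) (o : Ordinal.{0}) : Prop :=
  ∃ f : Idx δ → Ordinal.{0}, ordRank hU f = o ∧
    { i : Idx δ | ((f i).card).ord = f i } ∈ U

/-- The ordinal `o` is (the transitive collapse of) a regular cardinal of the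
ultrapower `Ult(V,U)`. -/
def RegularInUlt (hU : IsNormalUltrafilter δ U) (o : Ordinal.{0}) : Prop :=
  ∃ f : Idx δ → Ordinal.{0}, ordRank hU f = o ∧
    { i : Idx δ | ((f i).card).IsRegular ∧ ((f i).card).ord = f i } ∈ U

/-- The cardinal successor of the ordinal `o` as computed inside the ultrapower
`Ult(V,U)`: the least ordinal above `o` that is a cardinal in `Ult(V,U)`. -/
def succInUlt (hU : IsNormalUltrafilter δ U) (o : Ordinal.{0}) : Ordinal.{0} :=
  sInf { c : Ordinal.{0} | o < c ∧ CardInUlt hU c }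

/-- The cardinality of a set of ordinals, as an (initial) ordinal: the least ordinal
`o` such that `s` is the image of a function defined on the ordinals below `o`. -/
def setCardOrd (s : Set Ordinal.{0}) : Ordinal.{0} :=
  sInf { o : Ordinal.{0} | ∃ g : Ordinal.{0} → Ordinal.{0}, s ⊆ g '' Iio o }

theorem rank_lt_rank (hU : IsNormalUltrafilter δ U) {f g : Idx δ → Ordinal.{0}}
    (h : ultLT U f g) : ((ultLT_wf hU).apply f).rank < ((ultLT_wf hU).apply g).rank :=
  Acc.rank_lt_of_rel _ h

theorem ultLT_or_ae_eq_or_ultLT (f g : Idx δ → Ordinal.{0}) :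
    ultLT U f g ∨ { i | f i = g i } ∈ U ∨ ultLT U g f := by
  have h : ({ i | f i < g i } ∪ ({ i | f i = g i } ∪ { i | g i < f i }) : Set (Idx δ)) ∈ U := by
    refine Filter.mem_of_superset Filter.univ_mem fun i _ => ?_
    simpa using lt_trichotomy (f i) (g i)
  simpa only [ultLT, Ultrafilter.union_mem_iff] using h

theorem rank_congr (hU : IsNormalUltrafilter δ U) {f g : Idx δ → Ordinal.{0}}
    (h : { i | f i = g i } ∈ U) :
    ((ultLT_wf hU).apply f).rank = ((ultLT_wf hU).apply g).rank := by
  have key : ∀ {f g : Idx δ → Ordinal.{0}}, { i | f i = g i } ∈ U →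
      ((ultLT_wf hU).apply f).rank ≤ ((ultLT_wf hU).apply g).rank := by
    intro f g h
    rw [Acc.rank_eq]
    refine ciSup_le' fun b => Order.succ_le_of_lt (rank_lt_rank hU ?_)
    filter_upwards [b.2, h] with i h1 h2
    exact h1.trans_eq h2
  refine le_antisymm (key h) (key ?_)
  filter_upwards [h] with i hi using hi.symm

theorem lift_ordRank (hU : IsNormalUltrafilter δ U) (f : Idx δ → Ordinal.{0}) :
    Ordinal.lift.{1} (ordRank hU f) = ((ultLT_wf hU).apply f).rank := by
  suffices h : ∀ f, ∃ o : Ordinal.{0}, Ordinal.lift.{1} o = ((ultLT_wf hU).apply f).rank from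
    csInf_mem (s := { o : Ordinal.{0} | Ordinal.lift.{1} o = ((ultLT_wf hU).apply f).rank }) (h f)
  intro f
  induction f using (ultLT_wf hU).induction with
  | _ f ih =>
    let ι := { s : (i : Idx δ) → Iio (f i + 1) // ultLT U (fun i => (s i).1) f }
    have hidx : Small.{0} (Idx δ) := inferInstanceAs (Small.{0} (Iio δ.ord))
    have hι : Small.{0} ι := inferInstance
    choose a ha using fun s : ι => ih _ s.2
    refine Ordinal.mem_range_lift_of_le (a := ⨆ s, Order.succ (a s)) ?_
    rw [Acc.rank_eq]
    refine ciSup_le' fun b => ?_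
    let b' : (i : Idx δ) → Iio (f i + 1) :=
      fun i => ⟨min (b.1 i) (f i), Set.mem_Iio.2 (Order.lt_add_one_iff.2 (min_le_right _ _))⟩
    have hbb : { i | b.1 i = (b' i).1 } ∈ U := by
      filter_upwards [b.2] with i hi
      exact (min_eq_left (le_of_lt hi)).symm
    have hb' : ultLT U (fun i => (b' i).1) f := by
      filter_upwards [b.2] with i hi
      exact (min_le_left _ _).trans_lt hi
    rw [rank_congr hU hbb, ← ha ⟨b', hb'⟩, ← Ordinal.lift_succ, Ordinal.lift_le]
    exact Ordinal.le_iSup (fun s : ι => Order.succ (a s)) ⟨b', hb'⟩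

theorem ordRank_lt_iff (hU : IsNormalUltrafilter δ U) {f g : Idx δ → Ordinal.{0}} :
    ordRank hU f < ordRank hU g ↔ { i | f i < g i } ∈ U := by
  rw [← Ordinal.lift_lt.{1}, lift_ordRank, lift_ordRank]
  refine ⟨fun h => ?_, rank_lt_rank hU⟩
  rcases ultLT_or_ae_eq_or_ultLT (U := U) f g with h1 | h1 | h1
  · exact h1
  · exact absurd (rank_congr hU h1) h.ne
  · exact absurd (rank_lt_rank hU h1) h.not_gt

theorem ordRank_eq_iff (hU : IsNormalUltrafilter δ U) {f g : Idx δ → Ordinal.{0}} :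
    ordRank hU f = ordRank hU g ↔ { i | f i = g i } ∈ U := by
  rw [← Ordinal.lift_inj.{1, 0}, lift_ordRank, lift_ordRank]
  refine ⟨fun h => ?_, rank_congr hU⟩
  rcases ultLT_or_ae_eq_or_ultLT (U := U) f g with h1 | h1 | h1
  · exact absurd h (rank_lt_rank hU h1).ne
  · exact h1
  · exact absurd h (rank_lt_rank hU h1).ne'

theorem exists_ordRank_eq_of_le (hU : IsNormalUltrafilter δ U) {f : Idx δ → Ordinal.{0}}
    {o : Ordinal.{0}} (h : o ≤ ordRank hU f) : ∃ g, ordRank hU g = o := by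
  rw [← Ordinal.lift_le.{1}, lift_ordRank] at h
  obtain ⟨g, hg, hgo⟩ := Acc.mem_range_rank_of_le _ h
  exact ⟨g, Ordinal.lift_inj.1 ((lift_ordRank hU g).trans hgo)⟩

theorem ordRank_mem_ultSet (hU : IsNormalUltrafilter δ U) {f : Idx δ → Set Ordinal.{0}}
    {g : Idx δ → Ordinal.{0}} : ordRank hU g ∈ ultSet hU f ↔ { i | g i ∈ f i } ∈ U := by
  refine ⟨fun ⟨g', hg', h⟩ => ?_, fun h => ⟨g, h, rfl⟩⟩
  filter_upwards [hg', (ordRank_eq_iff hU).1 h] with i h1 h2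
  exact h2 ▸ h1

theorem IsNormalUltrafilter.lt_mem (hU : IsNormalUltrafilter δ U) {k : Ordinal.{0}}
    (hk : k < δ.ord) : { i : Idx δ | k < i.1 } ∈ U := by
  have hlim : Order.IsSuccLimit δ.ord := Cardinal.isSuccLimit_ord hU.uncountable.le
  have hcard : #(Shrink.{0} (Iio (k + 1))) < δ := by
    have h : (k + 1).card < δ := Cardinal.lt_ord.1 (hlim.add_one_lt hk)
    rw [← Cardinal.lift_lt.{0, 1}, Cardinal.lift_mk_shrink'', Cardinal.mk_Iio_ordinal]
    exact Cardinal.lift_lt.2 h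
  refine Filter.mem_of_superset (hU.complete (Shrink.{0} (Iio (k + 1)))
    (fun j => { x : Idx δ | x.1 ≠ ((equivShrink (Iio (k + 1))).symm j).1 }) hcard fun j => ?_) ?_
  · have hj : ((equivShrink (Iio (k + 1))).symm j).1 < δ.ord :=
      ((equivShrink (Iio (k + 1))).symm j).2.trans (hlim.add_one_lt hk)
    refine Filter.mem_of_superset (Ultrafilter.compl_mem_iff_notMem.2
      (hU.nonprincipal ⟨_, hj⟩)) fun x hx => ?_
    exact fun h => hx (Subtype.ext h)
  · intro x hx
    by_contra hkx
    have hkx' : x.1 ∈ Iio (k + 1) := Set.mem_Iio.2 (Order.lt_add_one_iff.2 (not_lt.1 hkx))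
    have := Set.mem_iInter.1 hx (equivShrink _ ⟨x.1, hkx'⟩)
    simp at this

theorem exists_cofinal_family {κ : Cardinal.{0}} (hκ : ℵ₀ < κ) (hcof : κ.ord.cof = δ) :
    ∃ c : Ordinal.{0} → Ordinal.{0}, (∀ k, Ordinal.omega0 ≤ c k ∧ c k < κ.ord) ∧
      ∀ o < κ.ord, ∃ k < δ.ord, o < c k := by
  have hlim : Order.IsSuccLimit κ.ord := Cardinal.isSuccLimit_ord hκ.le
  obtain ⟨s, hs, hsc⟩ := Order.exists_cof_eq (Iio κ.ord)
  rw [Ordinal.cof_Iio, ← Ordinal.lift_cof, hcof] at hsc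
  have he : #(Iio δ.ord) = #s := by rw [hsc, Cardinal.mk_Iio_ordinal, Cardinal.card_ord]
  obtain ⟨e⟩ := Cardinal.eq.1 he
  have hω : Ordinal.omega0 < κ.ord := by rwa [← Cardinal.ord_aleph0, Cardinal.ord_lt_ord]
  refine ⟨fun k => if h : k ∈ Iio δ.ord then max Ordinal.omega0 ((e ⟨k, h⟩).1.1 + 1)
    else Ordinal.omega0, fun k => ?_, fun o ho => ?_⟩
  · dsimp only
    split_ifs with h
    · exact ⟨le_max_left _ _, max_lt hω (hlim.add_one_lt (e ⟨k, h⟩).1.2)⟩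
    · exact ⟨le_rfl, hω⟩
  · obtain ⟨x, hx, hox⟩ := hs ⟨o, ho⟩
    obtain ⟨⟨k, hk⟩, hkx⟩ := e.surjective ⟨x, hx⟩
    refine ⟨k, hk, ?_⟩
    dsimp only
    rw [dif_pos hk, hkx]
    exact lt_max_of_lt_right (Order.lt_add_one_iff.2 hox)

theorem exists_continuous_family (hU : IsNormalUltrafilter δ U) {κ : Cardinal.{0}}
    (hκ : ℵ₀ < κ) (hcof : κ.ord.cof = δ) :
    ∃ l : Idx δ → Ordinal.{0}, (∀ i, Ordinal.omega0 ≤ l i ∧ l i < κ.ord) ∧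
      (∀ o < κ.ord, { i | o < l i } ∈ U) ∧
      ∀ t : Idx δ → Ordinal.{0}, { i | t i < l i } ∈ U → ∃ b < κ.ord, { i | t i < b } ∈ U := by
  obtain ⟨c, hc, hc'⟩ := exists_cofinal_family hκ hcof
  have hω : Ordinal.omega0 < κ.ord := (hc 0).1.trans_lt (hc 0).2
  have hbdd : ∀ i : Ordinal.{0}, BddAbove (c '' Iio i) :=
    fun i => ⟨κ.ord, by rintro _ ⟨k, -, rfl⟩; exact (hc k).2.le⟩
  refine ⟨fun i => max Ordinal.omega0 (sSup (c '' Iio i.1)), fun i => ⟨le_max_left _ _,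
    max_lt hω ?_⟩, fun o ho => ?_, fun t ht => ?_⟩
  · refine Ordinal.sSup_lt_of_lt_cof ?_ ?_
    · refine Cardinal.mk_image_le.trans_lt ?_
      rw [← Ordinal.lift_cof, hcof, Cardinal.mk_Iio_ordinal]
      exact Cardinal.lift_lt.2 (Cardinal.lt_ord.1 i.2)
    · rintro _ ⟨k, -, rfl⟩
      exact (hc k).2
  · obtain ⟨k, hk, hok⟩ := hc' o ho
    filter_upwards [hU.lt_mem hk] with i hi
    exact lt_max_of_lt_right (hok.trans_le (le_csSup (hbdd _) (mem_image_of_mem _ hi)))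
  · have hδ : 0 < δ.ord := Cardinal.ord_pos.2 (Cardinal.aleph0_pos.trans hU.uncountable)
    have hreg : ∀ i : Idx δ, 0 < i.1 ∧ t i < max Ordinal.omega0 (sSup (c '' Iio i.1)) →
        ∃ k < i.1, t i < c k := by
      rintro i ⟨hi, hti⟩
      rcases lt_max_iff.1 hti with h | h
      · exact ⟨0, hi, h.trans_le (hc 0).1⟩
      · obtain ⟨_, ⟨k, hk, rfl⟩, h'⟩ :=
          exists_lt_of_lt_csSup ⟨_, mem_image_of_mem c (Set.mem_Iio.2 hi)⟩ h
        exact ⟨k, hk, h'⟩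
    choose! k hk htk using hreg
    have hmem := Filter.inter_mem (hU.lt_mem hδ) ht
    obtain ⟨b, hb⟩ := hU.normal k (Filter.mem_of_superset hmem hk)
    refine ⟨c b, (hc b).2, ?_⟩
    filter_upwards [hmem, hb] with i h1 h2
    exact h2 ▸ htk i h1

theorem exists_injOn_Iio {a b : Ordinal.{0}} (h : a.card ≤ b.card) :
    ∃ f : Ordinal.{0} → Ordinal.{0}, (∀ x < a, f x < b) ∧ InjOn f (Iio a) := by
  have hab : #(Iio a) ≤ #(Iio b) := by
    rw [Cardinal.mk_Iio_ordinal, Cardinal.mk_Iio_ordinal]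
    exact Cardinal.lift_le.2 h
  obtain ⟨e⟩ := hab
  refine ⟨fun x => if hx : x ∈ Iio a then (e ⟨x, hx⟩).1 else 0, fun x hx => ?_,
    fun x hx y hy hxy => ?_⟩
  · dsimp only
    rw [dif_pos (Set.mem_Iio.2 hx)]
    exact (e ⟨x, hx⟩).2
  · dsimp only at hxy
    rw [dif_pos hx, dif_pos hy] at hxy
    exact congrArg Subtype.val (e.injective (Subtype.ext hxy))

theorem mk_bounded_functions_le {κ : Cardinal.{0}} (hκ : ℵ₀ ≤ κ)
    (hexp : ∀ μ : Cardinal.{0}, μ < κ → μ ^ δ < κ) :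
    #{ t : Idx δ → Ordinal.{0} | ∃ b < κ.ord, ∀ i, t i < b } ≤ Cardinal.lift.{1} κ := by
  have hT : { t : Idx δ → Ordinal.{0} | ∃ b < κ.ord, ∀ i, t i < b } =
      ⋃ b ∈ Iio κ.ord, { t : Idx δ → Ordinal.{0} | ∀ i, t i < b } := by
    ext t
    simp
  have hb : ∀ b : Iio κ.ord, #{ t : Idx δ → Ordinal.{0} | ∀ i, t i < b } ≤
      Cardinal.lift.{1} κ := by
    intro b
    have h : #{ t : Idx δ → Ordinal.{0} | ∀ i, t i < b } ≤ #(Idx δ → Iio b.1) :=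
      Cardinal.mk_le_of_injective (f := fun t i => ⟨t.1 i, t.2 i⟩) fun s t hst =>
        Subtype.ext (funext fun i => congrArg Subtype.val (congrFun hst i))
    have hδ : #(Idx δ) = Cardinal.lift.{1} δ := by
      rw [← Cardinal.card_ord δ, ← Cardinal.mk_Iio_ordinal, Cardinal.card_ord]
      rfl
    refine h.trans ?_
    rw [← Cardinal.power_def, hδ, Cardinal.mk_Iio_ordinal, ← Cardinal.lift_power]
    exact Cardinal.lift_le.2 (hexp _ (Cardinal.lt_ord.1 b.2)).le
  have hκ' : ℵ₀ ≤ Cardinal.lift.{1} κ := Cardinal.aleph0_le_lift.2 hκ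
  rw [hT]
  refine (Cardinal.mk_biUnion_le _ _).trans ?_
  rw [Cardinal.mk_Iio_ordinal, Cardinal.card_ord]
  exact Cardinal.mul_le_of_le hκ' le_rfl (ciSup_le' hb)

theorem ordRank_lt_succ_ord (hU : IsNormalUltrafilter δ U) {κ : Cardinal.{0}} (hκ : ℵ₀ ≤ κ)
    (hexp : ∀ μ : Cardinal.{0}, μ < κ → μ ^ δ < κ) {l f : Idx δ → Ordinal.{0}}
    (hl : ∀ t : Idx δ → Ordinal.{0}, { i | t i < l i } ∈ U → ∃ b < κ.ord, { i | t i < b } ∈ U)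
    (hf : ∀ i, (f i).card ≤ (l i).card) : ordRank hU f < (Order.succ κ).ord := by
  choose h hlt hinj using fun i => exists_injOn_Iio (hf i)
  have key : ∀ o : Iio (ordRank hU f),
      ∃ t : { t : Idx δ → Ordinal.{0} | ∃ b < κ.ord, ∀ i, t i < b },
        ∃ g, ordRank hU g = o.1 ∧ { i | g i < f i ∧ h i (g i) = t.1 i } ∈ U := by
    rintro ⟨o, ho⟩
    obtain ⟨g, rfl⟩ := exists_ordRank_eq_of_le hU (le_of_lt ho)
    have hg := (ordRank_lt_iff hU).1 ho
    obtain ⟨b, hb, hgb⟩ := hl (fun i => h i (g i))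
      (Filter.mem_of_superset hg fun i hi => hlt i _ hi)
    have hκ0 : 0 < κ.ord := Cardinal.ord_pos.2 (Cardinal.aleph0_pos.trans_le hκ)
    have hb0 : 0 < b := by
      obtain ⟨i, hi⟩ := Ultrafilter.nonempty_of_mem hgb
      exact (zero_le).trans_lt hi
    refine ⟨⟨fun i => if h i (g i) < b then h i (g i) else 0, b, hb, fun i => ?_⟩, g, rfl, ?_⟩
    · dsimp only
      split_ifs with hi
      · exact hi
      · exact hb0
    · filter_upwards [hg, hgb] with i h1 h2
      exact ⟨h1, (if_pos h2).symm⟩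
  choose t g hg hgt using key
  have htinj : Function.Injective t := by
    intro o o' hoo
    refine Subtype.ext ?_
    rw [← hg o, ← hg o', ordRank_eq_iff]
    filter_upwards [hgt o, hgt o'] with i h1 h2
    exact hinj i h1.1 h2.1 (h1.2.trans ((congrFun (congrArg Subtype.val hoo) i).trans h2.2.symm))
  have hle := (Cardinal.mk_le_of_injective htinj).trans (mk_bounded_functions_le hκ hexp)
  rw [Cardinal.mk_Iio_ordinal, Cardinal.lift_le] at hle
  exact Cardinal.lt_ord.2 (Order.lt_succ_of_le hle)

theorem exists_of_step {V : Type*} [Nonempty V] (P : Ordinal.{0} → (Ordinal.{0} → V) → Prop)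
    (hP : ∀ β A A', (∀ γ ≤ β, A γ = A' γ) → P β A → P β A')
    (step : ∀ β A, (∀ γ < β, P γ A) → ∃ v, P β (Function.update A β v)) :
    ∃ A, ∀ β, P β A := by
  classical
  obtain ⟨v₀⟩ := ‹Nonempty V›
  let pick : Ordinal.{0} → (Ordinal.{0} → V) → V := fun β A =>
    if h : ∃ v, P β (Function.update A β v) then h.choose else v₀
  let trunc : (β : Ordinal.{0}) → ((γ : Ordinal.{0}) → γ < β → V) → Ordinal.{0} → V :=
    fun β prev γ => if h : γ < β then prev γ h else v₀
  let A : Ordinal.{0} → V := Ordinal.lt_wf.fix fun β prev => pick β (trunc β prev)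
  have hA : ∀ β, A β = pick β (trunc β fun γ _ => A γ) := fun β => Ordinal.lt_wf.fix_eq _ _
  refine ⟨A, fun β => ?_⟩
  induction β using Ordinal.lt_wf.induction with
  | _ β ih =>
    have htr : ∀ γ < β, A γ = trunc β (fun γ _ => A γ) γ := fun γ hγ => by
      simp only [trunc, dif_pos hγ]
    have hex := step β (trunc β fun γ _ => A γ) fun γ hγ =>
      hP γ A _ (fun ξ hξ => htr ξ (hξ.trans_lt hγ)) (ih γ hγ)
    refine hP β _ A (fun γ hγ => ?_) hex.choose_spec
    rcases hγ.eq_or_lt with rfl | hlt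
    · rw [Function.update_self, hA]
      exact (dif_pos hex).symm
    · rw [Function.update_of_ne hlt.ne]
      exact (htr γ hlt).symm

/-- `T` is a chain for the tree-like family `A` when each of its elements below another one `γ`
belongs to `A γ`. -/
def IsChainFor (A : Ordinal.{0} → Set Ordinal.{0}) (T : Set Ordinal.{0}) : Prop :=
  ∀ γ ∈ T, ∀ γ' ∈ T, γ < γ' → γ ∈ A γ'

/-- The union of the branches of `A` determined by the elements of `T`. -/
def branchUnion (A : Ordinal.{0} → Set Ordinal.{0}) (T : Set Ordinal.{0}) : Set Ordinal.{0} :=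
  ⋃ γ ∈ T, insert γ (A γ)

theorem mem_branchUnion {A : Ordinal.{0} → Set Ordinal.{0}} {T : Set Ordinal.{0}}
    {α : Ordinal.{0}} : α ∈ branchUnion A T ↔ ∃ γ ∈ T, α = γ ∨ α ∈ A γ := by
  simp [branchUnion]

theorem branchUnion_coherent {A : Ordinal.{0} → Set Ordinal.{0}} {T : Set Ordinal.{0}}
    {β : Ordinal.{0}} (hTβ : T ⊆ Iio β) (hT : IsChainFor A T)
    (hsub : ∀ γ < β, A γ ⊆ Iio γ) (hcoh : ∀ γ < β, ∀ α ∈ A γ, A α = A γ ∩ Iio α) :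
    ∀ α ∈ branchUnion A T, A α = branchUnion A T ∩ Iio α := by
  have claim : ∀ γ ∈ T, ∀ α ∈ branchUnion A T, α < γ → α ∈ A γ := by
    intro γ hγ α hα hlt
    obtain ⟨γ₀, hγ₀, h⟩ := mem_branchUnion.1 hα
    rcases lt_trichotomy γ₀ γ with h1 | rfl | h1
    · have h2 := hT γ₀ hγ₀ γ hγ h1
      rcases h with rfl | h
      · exact h2
      · rw [hcoh γ (hTβ hγ) γ₀ h2] at h
        exact h.1
    · exact h.resolve_left hlt.ne
    · have h2 := hT γ hγ γ₀ hγ₀ h1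
      rw [hcoh γ₀ (hTβ hγ₀) γ h2]
      exact ⟨h.resolve_left (hlt.trans h1).ne, hlt⟩
  intro α hα
  obtain ⟨γ, hγ, h⟩ := mem_branchUnion.1 hα
  rcases h with rfl | h
  · ext x
    refine ⟨fun hx => ⟨mem_branchUnion.2 ⟨_, hγ, Or.inr hx⟩, hsub _ (hTβ hγ) hx⟩,
      fun hx => claim _ hγ x hx.1 hx.2⟩
  · rw [hcoh γ (hTβ hγ) α h]
    ext x
    refine ⟨fun hx => ⟨mem_branchUnion.2 ⟨_, hγ, Or.inr hx.1⟩, hx.2⟩,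
      fun hx => ⟨claim _ hγ x hx.1 (lt_trans hx.2 (hsub _ (hTβ hγ) h)), hx.2⟩⟩

theorem mk_branchUnion_le {A : Ordinal.{0} → Set Ordinal.{0}} {T : Set Ordinal.{0}}
    {c : Cardinal.{1}} (hc : ℵ₀ ≤ c) (hT : #T ≤ c) (hA : ∀ γ ∈ T, #(A γ) ≤ c) :
    #(branchUnion A T) ≤ c := by
  refine (Cardinal.mk_biUnion_le _ _).trans (Cardinal.mul_le_of_le hc hT (ciSup_le' fun γ => ?_))
  exact (Cardinal.mk_insert_le).trans
    (Cardinal.add_le_of_le hc (hA _ γ.2) (Cardinal.one_le_aleph0.trans hc))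

/-- The requirements on level `β` of a coherent system `A` of `δ`-indexed filtrations of the
ordinals: the `i`-th set at level `β` has at most `l i` elements, coheres with the earlier levels,
and contains those elements `γ` of `L β` whose weight `o γ` is below `l i`. -/
structure IsLevel (U : Ultrafilter (Idx δ)) (l : Idx δ → Ordinal.{0})
    (L : Ordinal.{0} → Set Ordinal.{0}) (o : Ordinal.{0} → Ordinal.{0}) (β : Ordinal.{0})
    (A : Ordinal.{0} → Idx δ → Set Ordinal.{0}) : Prop where
  subset : ∀ i, A β i ⊆ Iio β
  coherent : ∀ i, ∀ α ∈ A β i, A α i = A β i ∩ Iio α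
  card_le : ∀ i, #(A β i) ≤ Cardinal.lift.{1} (l i).card
  mem : ∀ α < β, { i | α ∈ A β i } ∈ U
  mem_of_weight_lt : ∀ γ ∈ L β, ∀ i, o γ < l i → γ ∈ A β i

theorem IsLevel.update {l : Idx δ → Ordinal.{0}} {L : Ordinal.{0} → Set Ordinal.{0}}
    {o : Ordinal.{0} → Ordinal.{0}} {β : Ordinal.{0}} {A : Ordinal.{0} → Idx δ → Set Ordinal.{0}}
    (hl : ∀ i, Ordinal.omega0 ≤ l i) (hA : ∀ γ < β, IsLevel U l L o γ A)
    (T : Idx δ → Set Ordinal.{0}) (hTβ : ∀ i, T i ⊆ Iio β)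
    (hT : ∀ i, IsChainFor (fun γ => A γ i) (T i))
    (hcard : ∀ i, #(T i) ≤ Cardinal.lift.{1} (l i).card)
    (hmem : ∀ α < β, { i | ∃ γ ∈ T i, α = γ ∨ α ∈ A γ i } ∈ U)
    (hL : ∀ γ ∈ L β, ∀ i, o γ < l i → ∃ γ' ∈ T i, γ = γ' ∨ γ ∈ A γ' i) :
    IsLevel U l L o β
      (Function.update A β fun i => branchUnion (fun γ => A γ i) (T i)) := by
  have hsub : ∀ i, branchUnion (fun γ => A γ i) (T i) ⊆ Iio β := by
    intro i α hα
    obtain ⟨γ, hγ, rfl | h⟩ := mem_branchUnion.1 hα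
    · exact hTβ i hγ
    · exact Set.mem_Iio.2 (lt_trans (Set.mem_Iio.1 ((hA γ (hTβ i hγ)).subset i h))
        (Set.mem_Iio.1 (hTβ i hγ)))
  constructor
  · intro i
    rw [Function.update_self]
    exact hsub i
  · intro i α hα
    rw [Function.update_self] at hα ⊢
    rw [Function.update_of_ne (hsub i hα).ne]
    exact branchUnion_coherent (hTβ i) (hT i) (fun γ hγ => (hA γ hγ).subset i)
      (fun γ hγ => (hA γ hγ).coherent i) α hα
  · intro i
    rw [Function.update_self]
    refine mk_branchUnion_le ?_ (hcard i) fun γ hγ => (hA γ (hTβ i hγ)).card_le i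
    exact Cardinal.aleph0_le_lift.2 (Ordinal.aleph0_le_card.2 (hl i))
  · intro α hα
    rw [Function.update_self]
    filter_upwards [hmem α hα] with i hi using mem_branchUnion.2 hi
  · intro γ hγ i hi
    rw [Function.update_self]
    exact mem_branchUnion.2 (hL γ hγ i hi)

theorem IsLevel.congr {l : Idx δ → Ordinal.{0}} {L : Ordinal.{0} → Set Ordinal.{0}}
    {o : Ordinal.{0} → Ordinal.{0}} {β : Ordinal.{0}} {A A' : Ordinal.{0} → Idx δ → Set Ordinal.{0}}
    (h : ∀ γ ≤ β, A γ = A' γ) (hA : IsLevel U l L o β A) : IsLevel U l L o β A' := by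
  obtain ⟨h1, h2, h3, h4, h5⟩ := hA
  rw [h β le_rfl] at h1 h3 h4 h5
  refine ⟨h1, fun i α hα => ?_, h3, h4, h5⟩
  rw [← h α (Set.mem_Iio.1 (h1 i hα)).le, ← h β le_rfl]
  exact h2 i α (h β le_rfl ▸ hα)

/-- The three ways in which the set `L β` can sit in `β`: it is unbounded; or `β` is the limit of
an increasing sequence starting with the largest element of `L β` (if there is one); or it is empty
and `β` is a successor ordinal (or zero). -/
def IsTame (L : Ordinal.{0} → Set Ordinal.{0}) (β : Ordinal.{0}) : Prop :=
  (∀ α < β, ∃ γ ∈ L β, α < γ) ∨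
  (∃ b : ℕ → Ordinal.{0}, StrictMono b ∧ (∀ n, b n < β) ∧ (∀ α < β, ∃ n, α < b n) ∧
    (∀ γ ∈ L β, γ ≤ b 0) ∧ (b 0 ∈ L β ∨ L β = ∅)) ∨
  (∃ α, β = α + 1) ∧ L β = ∅

theorem exists_update_isLevel (hU : IsNormalUltrafilter δ U) {κ : Cardinal.{0}}
    {l : Idx δ → Ordinal.{0}} (hl : ∀ i, Ordinal.omega0 ≤ l i)
    (hlU : ∀ o < κ.ord, { i | o < l i } ∈ U)
    {L : Ordinal.{0} → Set Ordinal.{0}} {o : Ordinal.{0} → Ordinal.{0}} {β : Ordinal.{0}}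
    {A : Ordinal.{0} → Idx δ → Set Ordinal.{0}}
    (hLβ : L β ⊆ Iio β) (hLL : ∀ γ ∈ L β, L γ = L β ∩ Iio γ)
    (ho : ∀ γ ∈ L β, ∀ γ' ∈ L β, γ < γ' → o γ < o γ') (hoκ : ∀ γ ∈ L β, o γ < κ.ord)
    (htame : IsTame L β) (hA : ∀ γ < β, IsLevel U l L o γ A) :
    ∃ v, IsLevel U l L o β (Function.update A β v) := by
  classical
  have hωl : ∀ i, ℵ₀ ≤ Cardinal.lift.{1} (l i).card := fun i =>
    Cardinal.aleph0_le_lift.2 (Ordinal.aleph0_le_card.2 (hl i))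
  let S : Idx δ → Set Ordinal.{0} := fun i => { γ | γ ∈ L β ∧ o γ < l i }
  have hSβ : ∀ i, S i ⊆ Iio β := fun i γ hγ => hLβ hγ.1
  have hS : ∀ i, IsChainFor (fun γ => A γ i) (S i) := fun i γ hγ γ' hγ' hlt =>
    (hA γ' (hSβ i hγ')).mem_of_weight_lt γ (by rw [hLL γ' hγ'.1]; exact ⟨hγ.1, hlt⟩) i hγ.2
  have hScard : ∀ i, #(S i) ≤ Cardinal.lift.{1} (l i).card := by
    intro i
    rw [← Cardinal.mk_Iio_ordinal]
    refine Cardinal.mk_le_of_injective (f := fun γ : S i => (⟨o γ, γ.2.2⟩ : Iio (l i))) ?_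
    intro γ γ' h
    have h' : o γ = o γ' := congrArg Subtype.val h
    refine Subtype.ext (le_antisymm (not_lt.1 fun hlt => ?_) (not_lt.1 fun hlt => ?_))
    · exact (ho _ γ'.2.1 _ γ.2.1 hlt).ne' h'
    · exact (ho _ γ.2.1 _ γ'.2.1 hlt).ne h'
  rcases htame with hcof | ⟨b, hb, hbβ, hbcof, hb0, hbL⟩ | ⟨⟨α, rfl⟩, hempty⟩
  · refine ⟨_, IsLevel.update hl hA S hSβ hS hScard (fun α hα => ?_)
      fun γ hγ i hi => ⟨γ, ⟨hγ, hi⟩, Or.inl rfl⟩⟩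
    obtain ⟨γ, hγ, hlt⟩ := hcof α hα
    filter_upwards [hlU _ (hoκ γ hγ), (hA γ (hLβ hγ)).mem α hlt] with i h1 h2
    exact ⟨γ, ⟨hγ, h1⟩, Or.inr h2⟩
  · let good : Idx δ → Prop := fun i => ∀ n, b n ∈ A (b (n + 1)) i
    have hgood : ∀ i, good i → IsChainFor (fun γ => A γ i) (range b) := by
      rintro i hi _ ⟨m, rfl⟩ _ ⟨n, rfl⟩ hlt
      have hmn : m < n := hb.lt_iff_lt.1 hlt
      clear hlt
      induction n, hmn using Nat.le_induction with
      | base => exact hi m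
      | succ n hmn ih =>
        change b m ∈ A (b n) i at ih
        rw [(hA _ (hbβ (n + 1))).coherent i _ (hi n)] at ih
        exact ih.1
    have hgoodU : { i | good i } ∈ U := by
      have := hU.complete ℕ (fun n => { i | b n ∈ A (b (n + 1)) i })
        (by rw [Cardinal.mk_nat]; exact hU.uncountable)
        fun n => (hA _ (hbβ (n + 1))).mem _ (hb (Nat.lt_succ_self n))
      filter_upwards [this] with i hi using Set.mem_iInter.1 hi
    refine ⟨_, IsLevel.update hl hA (fun i => if good i then range b else S i) (fun i => ?_)
      (fun i => ?_) (fun i => ?_) (fun α hα => ?_) fun γ hγ i hi => ?_⟩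
    · split_ifs
      · rintro _ ⟨n, rfl⟩
        exact hbβ n
      · exact hSβ i
    · split_ifs with h
      · exact hgood i h
      · exact hS i
    · split_ifs
      · exact (Cardinal.le_aleph0_iff_set_countable.2 (countable_range b)).trans (hωl i)
      · exact hScard i
    · obtain ⟨n, hn⟩ := hbcof α hα
      filter_upwards [hgoodU, (hA _ (hbβ n)).mem α hn] with i h1 h2
      refine ⟨b n, ?_, Or.inr h2⟩
      rw [if_pos (show good i from h1)]
      exact mem_range_self n
    · split_ifs with h
      · refine ⟨b 0, mem_range_self 0, (hb0 γ hγ).eq_or_lt.imp id fun hlt => ?_⟩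
        have hb0L : b 0 ∈ L β := hbL.resolve_right fun h => by simp [h] at hγ
        exact (hA _ (hbβ 0)).mem_of_weight_lt γ (by rw [hLL _ hb0L]; exact ⟨hγ, hlt⟩) i hi
      · exact ⟨γ, ⟨hγ, hi⟩, Or.inl rfl⟩
  · refine ⟨_, IsLevel.update hl hA (fun _ => {α}) (fun i => ?_) (fun i => ?_) (fun i => ?_)
      (fun ξ hξ => ?_) fun γ hγ i hi => ?_⟩
    · simp
    · rintro γ rfl γ' rfl h
      exact absurd h (lt_irrefl _)
    · rw [Cardinal.mk_singleton]
      exact Cardinal.one_le_aleph0.trans (hωl i)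
    · rcases (Order.lt_add_one_iff.1 hξ).eq_or_lt with rfl | hlt
      · exact Filter.mem_of_superset Filter.univ_mem fun i _ => ⟨_, rfl, Or.inl rfl⟩
      · filter_upwards [(hA α (Order.lt_add_one_iff.2 le_rfl)).mem ξ hlt] with i hi
        exact ⟨α, rfl, Or.inr hi⟩
    · simp [hempty] at hγ

theorem exists_isLevel (hU : IsNormalUltrafilter δ U) {κ : Cardinal.{0}}
    {l : Idx δ → Ordinal.{0}} (hl : ∀ i, Ordinal.omega0 ≤ l i)
    (hlU : ∀ o < κ.ord, { i | o < l i } ∈ U) {Θ : Ordinal.{0}}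
    {L : Ordinal.{0} → Set Ordinal.{0}} {o : Ordinal.{0} → Ordinal.{0}}
    (hLβ : ∀ β < Θ, L β ⊆ Iio β) (hLL : ∀ β < Θ, ∀ γ ∈ L β, L γ = L β ∩ Iio γ)
    (ho : ∀ β < Θ, ∀ γ ∈ L β, o γ < o β) (hoκ : ∀ β < Θ, ∀ γ ∈ L β, o γ < κ.ord)
    (htame : ∀ β < Θ, IsTame L β) :
    ∃ A, ∀ β < Θ, IsLevel U l L o β A := by
  refine exists_of_step (fun β A => β < Θ → IsLevel U l L o β A)
    (fun β A A' h hA hβ => (hA hβ).congr h) fun β A hA => ?_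
  by_cases hβ : β < Θ
  · obtain ⟨v, hv⟩ := exists_update_isLevel hU hl hlU (hLβ β hβ) (hLL β hβ)
      (fun γ hγ γ' hγ' hlt => ho γ' ((hLβ β hβ hγ').trans hβ) γ
        (by rw [hLL β hβ γ' hγ']; exact ⟨hγ, hlt⟩))
      (hoκ β hβ) (htame β hβ)
      fun γ hγ => hA γ hγ (hγ.trans hβ)
    exact ⟨v, fun _ => hv⟩
  · exact ⟨fun _ => ∅, fun h => absurd h hβ⟩

theorem mem_limitPts_iff {A : Set Ordinal.{0}} {b : Ordinal.{0}} :
    b ∈ limitPts A ↔ b ≠ 0 ∧ ∀ x < b, ∃ c ∈ A, x < c ∧ c < b := by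
  have hbdd : BddAbove (A ∩ Iio b) := ⟨b, fun c hc => hc.2.le⟩
  constructor
  · rintro ⟨hne, hb⟩
    refine ⟨fun h => ?_, fun x hx => ?_⟩
    · obtain ⟨c, hc⟩ := hne
      exact absurd (h ▸ hc.2 : c < 0) not_lt_zero
    · obtain ⟨c, hc, hxc⟩ := exists_lt_of_lt_csSup hne (hb.symm ▸ hx)
      exact ⟨c, hc.1, hxc, hc.2⟩
  · rintro ⟨h0, h⟩
    obtain ⟨c, hc, -, hcb⟩ := h 0 (pos_iff_ne_zero.2 h0)
    refine ⟨⟨c, hc, hcb⟩, le_antisymm (csSup_le ⟨c, hc, hcb⟩ fun d hd => hd.2.le) ?_⟩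
    refine le_of_forall_lt fun x hx => ?_
    obtain ⟨c, hc, hxc, hcb⟩ := h x hx
    exact hxc.trans_le (le_csSup hbdd ⟨hc, hcb⟩)

theorem isSuccLimit_of_mem_limitPts {A : Set Ordinal.{0}} {b : Ordinal.{0}}
    (h : b ∈ limitPts A) : Order.IsSuccLimit b := by
  obtain ⟨h0, h⟩ := mem_limitPts_iff.1 h
  refine Ordinal.isSuccLimit_iff.2 ⟨h0, Order.isSuccPrelimit_of_succ_lt fun x hx => ?_⟩
  obtain ⟨c, -, hxc, hcb⟩ := h x hx
  exact (Order.succ_le_of_lt hxc).trans_lt hcb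

theorem ClosedIn.mem_of_mem_limitPts {A : Set Ordinal.{0}} {β γ : Ordinal.{0}}
    (hA : ClosedIn A β) (hγ : γ ∈ limitPts A) (hlt : γ < β) : γ ∈ A := by
  have h := hA (A ∩ Iio γ) inter_subset_left hγ.1
  rw [hγ.2] at h
  exact h hlt

theorem mem_limitPts_inter_Iio {A : Set Ordinal.{0}} {γ ξ : Ordinal.{0}} (h : ξ < γ) :
    ξ ∈ limitPts (A ∩ Iio γ) ↔ ξ ∈ limitPts A := by
  have : A ∩ Iio γ ∩ Iio ξ = A ∩ Iio ξ := by
    rw [inter_assoc, inter_eq_self_of_subset_right (Iio_subset_Iio h.le)]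
  simp only [limitPts, mem_ofPred_eq, this]

/-- The limit points below `β` of the set attached to the limit ordinal `β`. -/
def limitPtsBelow (C : Ordinal.{0} → Set Ordinal.{0}) (β : Ordinal.{0}) : Set Ordinal.{0} :=
  { γ | Order.IsSuccLimit β ∧ γ ∈ limitPts (C β) ∧ γ < β }

/-- The least ordinal bounding the order type of `C`. -/
def leastOtp (C : Set Ordinal.{0}) : Ordinal.{0} :=
  sInf { o | otpLE C o }

theorem leastOtp_lt {C : Set Ordinal.{0}} {γ o : Ordinal.{0}} (hγ : γ ∈ C) (ho : otpLE C o) :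
    leastOtp (C ∩ Iio γ) < leastOtp C := by
  obtain ⟨g, hg, hg'⟩ : otpLE C (leastOtp C) := csInf_mem (s := { o | otpLE C o }) ⟨o, ho⟩
  refine lt_of_le_of_lt (csInf_le' ?_) (hg γ hγ)
  exact ⟨g, fun a ha => hg' a ha.1 γ hγ ha.2, fun a ha b hb => hg' a ha.1 b hb.1⟩

theorem exists_strictMono_of_bounded {C : Set Ordinal.{0}} {β b₀ : Ordinal.{0}}
    (hβ : Order.IsSuccLimit β) (hC : UnbSub C β) (hb₀ : b₀ < β)
    (hlim : ∀ γ ∈ limitPts C, γ < β → γ ≤ b₀) :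
    ∃ b : ℕ → Ordinal.{0}, StrictMono b ∧ b 0 = b₀ ∧ (∀ n, b n < β) ∧ ∀ α < β, ∃ n, α < b n := by
  have hnext : ∀ x, x < β → ∃ c ∈ C, x < c := fun x hx => by
    obtain ⟨c, hc, hxc⟩ := hC.2 (x + 1) (hβ.add_one_lt hx)
    exact ⟨c, hc, Order.add_one_le_iff.1 hxc⟩
  choose! s hsC hs using hnext
  have hlt : ∀ n, s^[n] b₀ < β := by
    intro n
    induction n with
    | zero => exact hb₀
    | succ n ih =>
      rw [Function.iterate_succ_apply']
      exact hC.1 (hsC _ ih)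
  have hmono : StrictMono fun n => s^[n] b₀ := strictMono_nat_of_lt_succ fun n => by
    rw [Function.iterate_succ_apply']
    exact hs _ (hlt n)
  refine ⟨fun n => s^[n] b₀, hmono, rfl, hlt, fun α hα => ?_⟩
  by_contra! hcon
  have hbdd : BddAbove (range fun n => s^[n] b₀) := ⟨β, by rintro _ ⟨n, rfl⟩; exact (hlt n).le⟩
  have hle : ∀ n, s^[n] b₀ ≤ ⨆ n, s^[n] b₀ := fun n => le_ciSup hbdd n
  have h1 : b₀ < ⨆ n, s^[n] b₀ := (hmono Nat.zero_lt_one).trans_le (hle 1)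
  refine (hlim _ (mem_limitPts_iff.2 ⟨h1.ne_bot, fun x hx => ?_⟩)
    ((ciSup_le hcon).trans_lt hα)).not_gt h1
  obtain ⟨n, hn⟩ := exists_lt_of_lt_ciSup hx
  refine ⟨s^[n + 1] b₀, ?_, hn.trans (hmono n.lt_succ_self),
    (hmono (n + 1).lt_succ_self).trans_le (hle _)⟩
  rw [Function.iterate_succ_apply']
  exact hsC _ (hlt n)

theorem isTame_limitPtsBelow {C : Ordinal.{0} → Set Ordinal.{0}} {β : Ordinal.{0}}
    (hC : Order.IsSuccLimit β → UnbSub (C β) β) : IsTame (limitPtsBelow C) β := by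
  by_cases hβ : Order.IsSuccLimit β
  · by_cases hcof : ∀ α < β, ∃ γ ∈ limitPtsBelow C β, α < γ
    · exact Or.inl hcof
    push Not at hcof
    obtain ⟨α, hα, hαL⟩ := hcof
    refine Or.inr (Or.inl ?_)
    rcases (limitPtsBelow C β).eq_empty_or_nonempty with he | hne
    · obtain ⟨b, hb, -, hbβ, hbcof⟩ := exists_strictMono_of_bounded hβ (hC hβ)
        (pos_iff_ne_zero.2 hβ.ne_bot) fun γ hγ hlt => by
          have : γ ∈ limitPtsBelow C β := ⟨hβ, hγ, hlt⟩
          simp [he] at this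
      exact ⟨b, hb, hbβ, hbcof, by simp [he], Or.inr he⟩
    · have hbdd : BddAbove (limitPtsBelow C β) := ⟨α, hαL⟩
      have hmem : sSup (limitPtsBelow C β) ∈ limitPtsBelow C β := by
        refine ⟨hβ, mem_limitPts_iff.2 ⟨?_, fun x hx => ?_⟩, (csSup_le hne hαL).trans_lt hα⟩
        · obtain ⟨γ, hγ⟩ := hne
          refine ne_of_gt (lt_of_lt_of_le ?_ (le_csSup hbdd hγ))
          exact pos_iff_ne_zero.2 (mem_limitPts_iff.1 hγ.2.1).1
        · obtain ⟨γ, hγ, hxγ⟩ := exists_lt_of_lt_csSup hne hx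
          obtain ⟨c, hc, hxc, hcγ⟩ := (mem_limitPts_iff.1 hγ.2.1).2 x hxγ
          exact ⟨c, hc, hxc, hcγ.trans_le (le_csSup hbdd hγ)⟩
      obtain ⟨b, hb, hb0, hbβ, hbcof⟩ := exists_strictMono_of_bounded hβ (hC hβ) hmem.2.2
        fun γ hγ hlt => le_csSup hbdd ⟨hβ, hγ, hlt⟩
      rw [← hb0] at hmem
      exact ⟨b, hb, hbβ, hbcof, fun γ hγ => hb0 ▸ le_csSup hbdd hγ, Or.inl hmem⟩
  · have hL : limitPtsBelow C β = ∅ := eq_empty_iff_forall_notMem.2 fun γ hγ => hβ hγ.1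
    rcases Ordinal.zero_or_succ_or_isSuccLimit β with rfl | ⟨α, rfl⟩ | h
    · exact Or.inl fun α hα => absurd hα not_lt_zero
    · exact Or.inr (Or.inr ⟨⟨α, rfl⟩, hL⟩)
    · exact absurd h hβ

/-- A square sequence on `κ⁺` yields a coherent system of filtrations of the ordinals below `κ⁺`,
indexed by `δ`. -/
theorem IsSquareKappaSeq.exists_isLevel (hU : IsNormalUltrafilter δ U) {κ : Cardinal.{0}}
    {l : Idx δ → Ordinal.{0}} (hl : ∀ i, Ordinal.omega0 ≤ l i)
    (hlU : ∀ o < κ.ord, { i | o < l i } ∈ U)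
    {C : Ordinal.{0} → Set Ordinal.{0}} (hC : IsSquareKappaSeq κ C) :
    ∃ L o A, ∀ β < (Order.succ κ).ord, IsLevel U l L o β A := by
  obtain ⟨hC, hotp⟩ := hC
  have hcoh : ∀ β < (Order.succ κ).ord, ∀ γ ∈ limitPtsBelow C β, C γ = C β ∩ Iio γ :=
    fun β hβ γ hγ => hC.coherent β hβ hγ.1 γ hγ.2.1 hγ.2.2
  have ho : ∀ β < (Order.succ κ).ord, ∀ γ ∈ limitPtsBelow C β,
      leastOtp (C γ) < leastOtp (C β) := fun β hβ γ hγ => by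
    rw [hcoh β hβ γ hγ]
    exact leastOtp_lt ((hC.closed β hβ hγ.1).mem_of_mem_limitPts hγ.2.1 hγ.2.2) (hotp β hβ hγ.1)
  refine ⟨limitPtsBelow C, fun β => leastOtp (C β), MU.exists_isLevel hU hl hlU
    (fun β _ γ hγ => hγ.2.2) (fun β hβ γ hγ => ?_) ho (fun β hβ γ hγ => (ho β hβ γ hγ).trans_le
      (csInf_le' (hotp β hβ hγ.1))) fun β hβ => isTame_limitPtsBelow (hC.unbounded β hβ)⟩
  ext ξ
  simp only [limitPtsBelow, mem_ofPred_eq, mem_inter_iff, mem_Iio]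
  rw [hcoh β hβ γ hγ]
  refine ⟨fun ⟨_, h1, h2⟩ => ⟨⟨hγ.1, (mem_limitPts_inter_Iio h2).1 h1, h2.trans hγ.2.2⟩, h2⟩,
    fun ⟨⟨_, h1, _⟩, h2⟩ => ⟨isSuccLimit_of_mem_limitPts hγ.2.1,
      (mem_limitPts_inter_Iio h2).2 h1, h2⟩⟩

theorem card_sSup_le {ι : Set Ordinal.{0}} {F : Ordinal.{0} → Ordinal.{0}} {c : Cardinal.{0}}
    (hc : ℵ₀ ≤ c) (hι : #ι ≤ Cardinal.lift.{1} c) (hF : ∀ ξ ∈ ι, (F ξ).card ≤ c) :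
    (sSup (F '' ι)).card ≤ c := by
  rw [← Cardinal.lift_le.{1}, ← Cardinal.mk_Iio_ordinal]
  have hsub : Iio (sSup (F '' ι)) ⊆ ⋃ ξ ∈ ι, Iio (F ξ) := fun x hx => by
    obtain ⟨_, ⟨ξ, hξ, rfl⟩, h⟩ := exists_lt_of_lt_csSup' (Set.mem_Iio.1 hx)
    exact mem_biUnion hξ h
  refine (Cardinal.mk_le_mk_of_subset hsub).trans ((Cardinal.mk_biUnion_le _ _).trans ?_)
  refine Cardinal.mul_le_of_le (Cardinal.aleph0_le_lift.2 hc) hι (ciSup_le' fun ξ => ?_)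
  rw [Cardinal.mk_Iio_ordinal]
  exact Cardinal.lift_le.2 (hF _ ξ.2)

/-- A coherent system of filtrations is ranked by functions whose values are small successor
ordinals. -/
theorem exists_ranking {l : Idx δ → Ordinal.{0}} (hl : ∀ i, Ordinal.omega0 ≤ l i)
    {Θ : Ordinal.{0}} {A : Ordinal.{0} → Idx δ → Set Ordinal.{0}}
    (hA : ∀ β < Θ, ∀ i, A β i ⊆ Iio β)
    (hcard : ∀ β < Θ, ∀ i, #(A β i) ≤ Cardinal.lift.{1} (l i).card) :
    ∃ f : Ordinal.{0} → Idx δ → Ordinal.{0}, ∀ β < Θ, ∀ i, (∀ ξ ∈ A β i, f ξ i < f β i) ∧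
      (∃ p, f β i = p + 1) ∧ (f β i).card ≤ (l i).card := by
  have hωl : ∀ i, ℵ₀ ≤ (l i).card := fun i => Ordinal.aleph0_le_card.2 (hl i)
  have hsucc : ∀ i (x : Ordinal.{0}), x.card ≤ (l i).card → (x + 1).card ≤ (l i).card := by
    intro i x hx
    rw [Ordinal.card_add, Ordinal.card_one]
    exact Cardinal.add_le_of_le (hωl i) hx (Cardinal.one_le_aleph0.trans (hωl i))
  refine exists_of_step (fun β (f : Ordinal.{0} → Idx δ → Ordinal.{0}) =>
      β < Θ → ∀ i, (∀ ξ ∈ A β i, f ξ i < f β i) ∧ (∃ p, f β i = p + 1) ∧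
        (f β i).card ≤ (l i).card) (fun β f f' h hf hβ i => ?_)
    fun β f hf => ⟨fun i => sSup ((fun ξ => f ξ i + 1) '' A β i) + 1, fun hβ i => ?_⟩
  · rw [← h β le_rfl]
    refine ⟨fun ξ hξ => ?_, (hf hβ i).2⟩
    rw [← h ξ (Set.mem_Iio.1 (hA β hβ i hξ)).le]
    exact (hf hβ i).1 ξ hξ
  · rw [Function.update_self]
    refine ⟨fun ξ hξ => ?_, ⟨_, rfl⟩, hsucc i _ (card_sSup_le (hωl i) (hcard β hβ i)
      fun ξ hξ => ?_)⟩
    · rw [Function.update_of_ne (Set.mem_Iio.1 (hA β hβ i hξ)).ne]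
      have : Small.{0} (A β i) := small_subset (hA β hβ i)
      refine Order.lt_add_one_iff.2 (le_trans ?_ (le_csSup (Ordinal.bddAbove_of_small)
        (mem_image_of_mem _ hξ)))
      exact (Order.lt_add_one_iff.2 le_rfl).le
    · exact hsucc i _ (hf ξ (hA β hβ i hξ) ((hA β hβ i hξ).trans hβ) i).2.2

theorem exists_enumeration {κ : Cardinal.{0}} (hκ : ℵ₀ ≤ κ) (hδ : δ ≠ 0) (hδκ : δ ≤ κ)
    (hgch : (2 : Cardinal.{0}) ^ κ = Order.succ κ) :
    ∃ F : Ordinal.{0} → Idx δ → Set Ordinal.{0}, ∀ h : Idx δ → Set Ordinal.{0},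
      (∀ i, h i ⊆ Iio κ.ord) → ∃ ξ < (Order.succ κ).ord, F ξ = h := by
  have hIdx : #(Idx δ) = Cardinal.lift.{1} δ := by
    have := Cardinal.mk_Iio_ordinal δ.ord
    rwa [Cardinal.card_ord] at this
  have hcard : #(Idx δ → Set (Iio κ.ord)) = #(Iio (Order.succ κ).ord) := by
    rw [← Cardinal.power_def, Cardinal.mk_set, hIdx, Cardinal.mk_Iio_ordinal,
      Cardinal.mk_Iio_ordinal, Cardinal.card_ord, Cardinal.card_ord, ← Cardinal.power_mul,
      ← Cardinal.lift_mul, Cardinal.mul_eq_left hκ hδκ hδ, ← hgch, Cardinal.lift_power,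
      Cardinal.lift_two]
  obtain ⟨e⟩ := Cardinal.eq.1 hcard
  classical
  refine ⟨fun ξ i => if hξ : ξ ∈ Iio (Order.succ κ).ord then
    Subtype.val '' (e.symm ⟨ξ, hξ⟩ i) else ∅, fun h hh => ?_⟩
  refine ⟨(e fun i => Subtype.val ⁻¹' h i).1, (e fun i => Subtype.val ⁻¹' h i).2, ?_⟩
  funext i
  dsimp only
  rw [dif_pos (e fun i => Subtype.val ⁻¹' h i).2, Subtype.coe_eta, Equiv.symm_apply_apply,
    Subtype.image_preimage_coe, inter_eq_right.2 (hh i)]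

section Diagonal

variable (A : Ordinal.{0} → Idx δ → Set Ordinal.{0}) (f : Ordinal.{0} → Idx δ → Ordinal.{0})
  (X : Set Ordinal.{0})

/-- The ordinals below `f β i` that are not of the form `f ξ i` with `ξ ∈ X ∩ A β i`. -/
def omitting (β : Ordinal.{0}) (i : Idx δ) : Set Ordinal.{0} :=
  Iio (f β i) \ ((fun ξ => f ξ i) '' (X ∩ A β i))

/-- The union of the sets represented by `omitting A f X β` for `β < Θ`. -/
def omittingClub (hU : IsNormalUltrafilter δ U) (Θ : Ordinal.{0}) : Set Ordinal.{0} :=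
  { o | ∃ β < Θ, o ∈ ultSet hU (omitting A f X β) }

/-- `f` ranks the coherent system `A` of filtrations of the ordinals below `Θ`, with successor
values, and represents ordinals below `Θ`. -/
structure IsRankedSystem (hU : IsNormalUltrafilter δ U) (Θ : Ordinal.{0}) : Prop where
  subset : ∀ β < Θ, ∀ i, A β i ⊆ Iio β
  coherent : ∀ β < Θ, ∀ i, ∀ α ∈ A β i, A α i = A β i ∩ Iio α
  mem : ∀ β < Θ, ∀ α < β, { i | α ∈ A β i } ∈ U
  lt : ∀ β < Θ, ∀ i, ∀ α ∈ A β i, f α i < f β i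
  succ : ∀ β < Θ, ∀ i, ∃ p, f β i = p + 1
  rank_lt : ∀ β < Θ, ordRank hU (f β) < Θ

variable {A f X} {hU : IsNormalUltrafilter δ U} {Θ : Ordinal.{0}}

namespace IsRankedSystem

theorem lt_of_mem (h : IsRankedSystem A f hU Θ) {β α ξ : Ordinal.{0}} (hβ : β < Θ) {i : Idx δ}
    (hα : α ∈ A β i) (hξ : ξ ∈ A β i) (hlt : α < ξ) : f α i < f ξ i := by
  refine h.lt ξ ((Set.mem_Iio.1 (h.subset β hβ i hξ)).trans hβ) i α ?_
  rw [h.coherent β hβ i ξ hξ]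
  exact ⟨hα, hlt⟩

theorem le_rank (h : IsRankedSystem A f hU Θ) {β : Ordinal.{0}} (hβ : β < Θ) :
    β ≤ ordRank hU (f β) := by
  induction β using Ordinal.lt_wf.induction with
  | _ β ih =>
    refine le_of_forall_lt fun γ hγ => (ih γ hγ (hγ.trans hβ)).trans_lt ?_
    rw [ordRank_lt_iff]
    filter_upwards [h.mem β hβ γ hγ] with i hi using h.lt β hβ i γ hi

theorem omitting_inter (h : IsRankedSystem A f hU Θ) {α β : Ordinal.{0}} (hβ : β < Θ) {i : Idx δ}
    (hα : α ∈ A β i) : omitting A f X β i ∩ Iio (f α i) = omitting A f X α i := by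
  have hcoh := h.coherent β hβ i α hα
  ext x
  constructor
  · rintro ⟨⟨-, hx⟩, hlt⟩
    refine ⟨hlt, fun hx' => hx ?_⟩
    obtain ⟨ξ, ⟨hξX, hξ⟩, rfl⟩ := hx'
    exact ⟨ξ, ⟨hξX, (hcoh ▸ hξ : ξ ∈ A β i ∩ Iio α).1⟩, rfl⟩
  · rintro ⟨hlt, hx⟩
    refine ⟨⟨lt_trans (Set.mem_Iio.1 hlt) (h.lt β hβ i α hα), fun hx' => ?_⟩, hlt⟩
    obtain ⟨ξ, ⟨hξX, hξ⟩, rfl⟩ := hx'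
    rcases lt_trichotomy ξ α with h1 | rfl | h1
    · exact hx ⟨ξ, ⟨hξX, hcoh ▸ ⟨hξ, h1⟩⟩, rfl⟩
    · exact lt_irrefl _ (Set.mem_Iio.1 hlt)
    · exact (h.lt_of_mem hβ hα hξ h1).asymm hlt

theorem ordRank_mem_omittingClub (h : IsRankedSystem A f hU Θ) {α : Ordinal.{0}} (hα : α < Θ)
    {g : Idx δ → Ordinal.{0}} (hg : { i | g i < f α i } ∈ U) :
    ordRank hU g ∈ omittingClub A f X hU Θ ↔ { i | g i ∈ omitting A f X α i } ∈ U := by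
  refine ⟨fun ⟨β, hβ, hgβ⟩ => ?_, fun hg => ⟨α, hα, (ordRank_mem_ultSet hU).2 hg⟩⟩
  rw [ordRank_mem_ultSet] at hgβ
  rcases lt_trichotomy α β with h1 | rfl | h1
  · filter_upwards [hg, hgβ, h.mem β hβ α h1] with i h2 h3 h4
    rw [← h.omitting_inter hβ h4]
    exact ⟨h3, h2⟩
  · exact hgβ
  · filter_upwards [hgβ, h.mem α hα β h1] with i h3 h4
    rw [← h.omitting_inter hα h4] at h3
    exact h3.1

theorem omittingClub_subset (h : IsRankedSystem A f hU Θ) :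
    omittingClub A f X hU Θ ⊆ Iio Θ := by
  rintro _ ⟨β, hβ, g, hg, rfl⟩
  refine lt_trans ?_ (h.rank_lt β hβ)
  rw [ordRank_lt_iff]
  filter_upwards [hg] with i hi using hi.1

theorem exists_representative (h : IsRankedSystem A f hU Θ) (hΘ : Order.IsSuccLimit Θ)
    {o : Ordinal.{0}} (ho : o < Θ) :
    ∃ β < Θ, ∃ g, ordRank hU g = o ∧ { i | g i < f β i } ∈ U := by
  have ho' := hΘ.add_one_lt ho
  have hlt : o < ordRank hU (f (o + 1)) := Order.add_one_le_iff.1 (h.le_rank ho')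
  obtain ⟨g, rfl⟩ := exists_ordRank_eq_of_le hU hlt.le
  exact ⟨_, ho', g, rfl, (ordRank_lt_iff hU).1 hlt⟩

theorem rank_mem_omittingClub (h : IsRankedSystem A f hU Θ) (hΘ : Order.IsSuccLimit Θ)
    {ξ : Ordinal.{0}} (hξ : ξ < Θ) :
    ordRank hU (f ξ) ∈ omittingClub A f X hU Θ ↔ ξ ∉ X := by
  have hξ' := hΘ.add_one_lt hξ
  have hmem := h.mem _ hξ' ξ (Order.lt_add_one_iff.2 le_rfl)
  rw [h.ordRank_mem_omittingClub hξ' (by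
    filter_upwards [hmem] with i hi using h.lt _ hξ' i ξ hi)]
  constructor
  · intro h1 hX
    obtain ⟨i, h2, h3⟩ := Ultrafilter.nonempty_of_mem (Filter.inter_mem h1 hmem)
    exact h2.2 ⟨ξ, ⟨hX, h3⟩, rfl⟩
  · intro hX
    filter_upwards [hmem] with i hi
    refine ⟨h.lt _ hξ' i ξ hi, ?_⟩
    rintro ⟨η, ⟨hηX, hη⟩, heq⟩
    rcases lt_trichotomy η ξ with h1 | rfl | h1
    · exact (h.lt_of_mem hξ' hη hi h1).ne heq
    · exact hX hηX
    · exact (h.lt_of_mem hξ' hi hη h1).ne' heq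

/-- An ordinal below `Θ` outside `omittingClub` is, in the ultrapower, a successor. -/
theorem exists_succ_representative (h : IsRankedSystem A f hU Θ) (hΘ : Order.IsSuccLimit Θ)
    {o : Ordinal.{0}} (ho : o < Θ) (hoD : o ∉ omittingClub A f X hU Θ) :
    ∃ p : Idx δ → Ordinal.{0}, ordRank hU (fun i => p i + 1) = o := by
  obtain ⟨β, hβ, g, rfl, hg⟩ := h.exists_representative hΘ ho
  rw [h.ordRank_mem_omittingClub hβ hg, ← Ultrafilter.compl_mem_iff_notMem] at hoD
  have hsucc : ∀ i, g i < f β i ∧ g i ∉ omitting A f X β i → ∃ p, p + 1 = g i := by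
    rintro i ⟨h1, h2⟩
    have h3 : g i ∈ (fun ξ => f ξ i) '' (X ∩ A β i) := by
      by_contra h3
      exact h2 ⟨h1, h3⟩
    obtain ⟨ξ, ⟨-, hξ⟩, heq⟩ := h3
    obtain ⟨p, hp⟩ := h.succ ξ ((Set.mem_Iio.1 (h.subset β hβ i hξ)).trans hβ) i
    exact ⟨p, hp.symm.trans heq⟩
  choose! p hp using hsucc
  refine ⟨p, (ordRank_eq_iff hU).2 ?_⟩
  filter_upwards [hg, hoD] with i h1 h2 using hp i ⟨h1, h2⟩

end IsRankedSystem

theorem le_of_lt_ordRank_add_one (hU : IsNormalUltrafilter δ U) {p : Idx δ → Ordinal.{0}}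
    {s : Ordinal.{0}} (hs : s < ordRank hU fun i => p i + 1) : s ≤ ordRank hU p := by
  obtain ⟨g, rfl⟩ := exists_ordRank_eq_of_le hU hs.le
  refine not_lt.1 fun hlt => ?_
  rw [ordRank_lt_iff] at hs hlt
  obtain ⟨i, h1, h2⟩ := Ultrafilter.nonempty_of_mem (Filter.inter_mem hs hlt)
  exact (Order.lt_add_one_iff.1 (show g i < p i + 1 from h1)).not_gt h2

theorem ordRank_lt_ordRank_add_one (hU : IsNormalUltrafilter δ U) (p : Idx δ → Ordinal.{0}) :
    ordRank hU p < ordRank hU fun i => p i + 1 :=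
  (ordRank_lt_iff hU).2 (Filter.mem_of_superset Filter.univ_mem
    fun i _ => show p i < p i + 1 from Order.lt_add_one_iff.2 le_rfl)

namespace IsRankedSystem

theorem closedIn_omittingClub (h : IsRankedSystem A f hU Θ) (hΘ : Order.IsSuccLimit Θ) :
    ClosedIn (omittingClub A f X hU Θ) Θ := by
  intro S hS hne hlt
  by_contra hcon
  obtain ⟨p, hp⟩ := h.exists_succ_representative hΘ hlt hcon
  have hbdd : BddAbove S := ⟨Θ, fun s hs => (Set.mem_Iio.1 (h.omittingClub_subset (hS hs))).le⟩
  obtain ⟨s, hs, hps⟩ := exists_lt_of_lt_csSup hne (hp ▸ ordRank_lt_ordRank_add_one hU p)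
  rcases (le_csSup hbdd hs).eq_or_lt with heq | hlt'
  · exact hcon (heq ▸ hS hs)
  · exact (le_of_lt_ordRank_add_one hU (hp ▸ hlt')).not_gt hps

theorem unbSub_omittingClub (h : IsRankedSystem A f hU Θ) (hΘ : Order.IsSuccLimit Θ)
    (hΘ' : ∀ b < Θ, ∃ c < Θ, b ≤ c ∧ Order.IsSuccLimit c) :
    UnbSub (omittingClub A f X hU Θ) Θ := by
  refine ⟨h.omittingClub_subset, fun b hb => ?_⟩
  obtain ⟨c, hc, hbc, hlim⟩ := hΘ' b hb
  refine ⟨c, ?_, hbc⟩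
  by_contra hcon
  obtain ⟨p, rfl⟩ := h.exists_succ_representative hΘ hc hcon
  have h1 := hlim.add_one_lt (ordRank_lt_ordRank_add_one hU p)
  exact (le_of_lt_ordRank_add_one hU h1).not_gt (Order.lt_add_one_iff.2 le_rfl)

theorem inUlt_omittingClub_inter (h : IsRankedSystem A f hU Θ) (hΘ : Order.IsSuccLimit Θ)
    {α : Ordinal.{0}} (hα : α < Θ) : InUlt hU (omittingClub A f X hU Θ ∩ Iio α) := by
  obtain ⟨β, hβ, g, rfl, hg⟩ := h.exists_representative hΘ hα
  refine ⟨fun i => omitting A f X β i ∩ Iio (g i), fun i => ⟨g i, fun x hx => hx.2.le⟩, ?_⟩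
  have key : ∀ q : Idx δ → Ordinal.{0}, ordRank hU q < ordRank hU g →
      { i | q i < g i } ∈ U ∧ { i | q i < f β i } ∈ U := fun q hq => by
    rw [ordRank_lt_iff] at hq
    refine ⟨hq, ?_⟩
    filter_upwards [hq, hg] with i h1 h2 using lt_trans h1 h2
  ext o
  constructor
  · rintro ⟨ho, hlt⟩
    obtain ⟨q, rfl⟩ := exists_ordRank_eq_of_le hU (Set.mem_Iio.1 hlt).le
    obtain ⟨h1, h2⟩ := key q hlt
    rw [h.ordRank_mem_omittingClub hβ h2] at ho
    exact ⟨q, Filter.inter_mem ho h1, rfl⟩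
  · rintro ⟨q, hq, rfl⟩
    have hlt : ordRank hU q < ordRank hU g := (ordRank_lt_iff hU).2 (by
      filter_upwards [hq] with i hi using hi.2)
    refine ⟨(h.ordRank_mem_omittingClub hβ (key q hlt).2).2 ?_, hlt⟩
    filter_upwards [hq] with i hi using hi.1

theorem fresh_omittingClub (h : IsRankedSystem A f hU Θ) (hΘ : Order.IsSuccLimit Θ)
    {k : Ordinal.{0}} (hf : ∀ β < Θ, ∀ i, f β i < k) {F : Ordinal.{0} → Idx δ → Set Ordinal.{0}}
    (hF : ∀ t : Idx δ → Set Ordinal.{0}, (∀ i, t i ⊆ Iio k) → ∃ ξ < Θ, F ξ = t) :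
    Fresh hU (omittingClub A f { ξ | ordRank hU (f ξ) ∈ ultSet hU (F ξ) } hU Θ) := by
  refine ⟨?_, fun α hα => h.inUlt_omittingClub_inter hΘ (hα.trans_le (csSup_le' ?_))⟩
  · rintro ⟨t, -, ht⟩
    obtain ⟨ξ, hξ, hFξ⟩ := hF (fun i => t i ∩ Iio k) fun i => inter_subset_right
    have h1 := h.rank_mem_omittingClub (X := { ξ | ordRank hU (f ξ) ∈ ultSet hU (F ξ) }) hΘ hξ
    rw [ht, mem_ofPred_eq, hFξ, ordRank_mem_ultSet, ordRank_mem_ultSet] at h1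
    have h2 : { i | f ξ i ∈ t i ∩ Iio k } = { i | f ξ i ∈ t i } := by
      ext i
      exact ⟨fun hi => hi.1, fun hi => ⟨hi, hf ξ hξ i⟩⟩
    rw [h2] at h1
    exact iff_not_self h1
  · rintro _ ⟨o, ho, rfl⟩
    exact Order.add_one_le_iff.2 (h.omittingClub_subset ho)

end IsRankedSystem

end Diagonal

/-- If `κ` is a singular cardinal of cofinality `δ` with `2^κ = κ⁺` and `λ^δ < κ`
for all `λ < κ`, and `κ` carries a `□_κ`-sequence, then there is a closed unbounded
subset of `κ⁺` that is fresh over `Ult(V,U)`. -/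
theorem stmt16 (δ : Cardinal.{0}) (U : Ultrafilter (Idx δ)) (hU : IsNormalUltrafilter δ U)
    (κ : Cardinal.{0}) (hsing : IsSingular κ) (hcof : κ.ord.cof = δ)
    (hgch : (2 : Cardinal.{0}) ^ κ = Order.succ κ)
    (hexp : ∀ μ : Cardinal.{0}, μ < κ → μ ^ δ < κ)
    (hsq : ∃ C : Ordinal.{0} → Set Ordinal.{0}, IsSquareKappaSeq κ C) :
    ∃ A : Set Ordinal.{0}, ClosedIn A (Order.succ κ).ord ∧
      UnbSub A (Order.succ κ).ord ∧ Fresh hU A := by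
  have hδκ : δ < κ := hcof ▸ hsing.2
  have hκ : ℵ₀ < κ := hU.uncountable.trans hδκ
  obtain ⟨l, hl, hlU, hlreg⟩ := exists_continuous_family hU hκ hcof
  obtain ⟨C, hC⟩ := hsq
  obtain ⟨L, o, A, hA⟩ := hC.exists_isLevel hU (fun i => (hl i).1) hlU
  obtain ⟨f, hf⟩ := exists_ranking (fun i => (hl i).1) (fun β hβ => (hA β hβ).subset)
    fun β hβ => (hA β hβ).card_le
  obtain ⟨F, hF⟩ := exists_enumeration (δ := δ) hκ.le
    (Cardinal.aleph0_pos.trans hU.uncountable).ne' hδκ.le hgch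
  have hsys : IsRankedSystem A f hU (Order.succ κ).ord :=
    { subset := fun β hβ => (hA β hβ).subset
      coherent := fun β hβ => (hA β hβ).coherent
      mem := fun β hβ => (hA β hβ).mem
      lt := fun β hβ i => (hf β hβ i).1
      succ := fun β hβ i => (hf β hβ i).2.1
      rank_lt := fun β hβ => ordRank_lt_succ_ord hU hκ.le hexp hlreg fun i => (hf β hβ i).2.2 }
  have hsucc : ℵ₀ < Order.succ κ := hκ.trans (Order.lt_succ κ)
  have hΘ : Order.IsSuccLimit (Order.succ κ).ord := Cardinal.isSuccLimit_ord hsucc.le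
  refine ⟨_, hsys.closedIn_omittingClub hΘ, hsys.unbSub_omittingClub hΘ fun b hb => ?_,
    hsys.fresh_omittingClub hΘ (fun β hβ i => ?_) hF⟩
  · refine ⟨b + Ordinal.omega0, ?_, le_self_add,
      Ordinal.isSuccLimit_add b Ordinal.isSuccLimit_omega0⟩
    refine Ordinal.isPrincipal_add_ord hsucc.le hb ?_
    rwa [← Cardinal.ord_aleph0, Cardinal.ord_lt_ord]
  · exact Cardinal.lt_ord.2 ((hf β hβ i).2.2.trans_lt (Cardinal.lt_ord.1 (hl i).2))

end MU
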